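/- Let X be a measurable space and V a vector space over ℚ of countable dimension. Let x ↦ T_x, x ↦ p_x, x ↦ q_x be measurable fields of ℚ-linear operators on V, with p_x and q_x idempotent for every x, and assume that for every x the operator T_x maps ker q_x bijectively onto range p_x. For each x let S_x : V → V be the unique ℚ-linear operator that vanishes on ker p_x, has range contained in ker q_x, and satisfies T_x ∘ S_x = p_x (i.e., S_x is zero on ker p_x and on range p_x is the inverse of the bijection T_x : ker q_x → range p_x). Then the field x ↦ S_x is measurable, i.e., for every v ∈ V the map x ↦ S_x(v) is measurable. -/

import Mathlib

open Cardinal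

/-- A rational vector space of countable dimension is a countable set. -/
theorem countable_of_rank_le_aleph0 {V : Type*} [AddCommGroup V] [Module ℚ V]
    (hdim : Module.rank ℚ V ≤ ℵ₀) : Countable V := by
  let b := Module.Basis.ofVectorSpace ℚ V
  have : Countable (Module.Basis.ofVectorSpaceIndex ℚ V) := by
    rw [← mk_le_aleph0_iff, b.mk_eq_rank'']
    exact hdim
  exact b.repr.toEquiv.countable_iff.mpr inferInstance

/-- **Lemma 6 (lhomo).** Let `X` be a measurable space and `V` a `ℚ`-vector
space of countable dimension with the discrete σ-algebra. Let `x ↦ T x`,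
`x ↦ p x`, `x ↦ q x` be measurable fields of `ℚ`-linear operators on `V`
with `p x` and `q x` idempotent, such that `T x` maps `ker (q x)` bijectively
onto `range (p x)`. If `x ↦ S x` is the field of operators determined by:
`S x` vanishes on `ker (p x)`, `range (S x) ⊆ ker (q x)` and
`T x ∘ S x = p x`, then `x ↦ S x` is measurable. -/
theorem stmt_2 {X V : Type*} [MeasurableSpace X]
    [AddCommGroup V] [Module ℚ V] [MeasurableSpace V]
    (hdisc : ∀ s : Set V, MeasurableSet s)
    (hdim : Module.rank ℚ V ≤ ℵ₀)
    (T p q S : X → (V →ₗ[ℚ] V))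
    (hTmeas : ∀ v : V, Measurable fun x => T x v)
    (hpmeas : ∀ v : V, Measurable fun x => p x v)
    (hqmeas : ∀ v : V, Measurable fun x => q x v)
    (hp : ∀ x, (p x) ∘ₗ (p x) = p x)
    (hq : ∀ x, (q x) ∘ₗ (q x) = q x)
    (hbij : ∀ x, Set.BijOn (T x) (LinearMap.ker (q x)) (LinearMap.range (p x)))
    (hS0 : ∀ x, ∀ v ∈ LinearMap.ker (p x), S x v = 0)
    (hSrange : ∀ x, LinearMap.range (S x) ≤ LinearMap.ker (q x))
    (hTS : ∀ x, (T x) ∘ₗ (S x) = p x) :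
    ∀ v : V, Measurable fun x => S x v := by
  have : DiscreteMeasurableSpace V := ⟨hdisc⟩
  have : Countable V := countable_of_rank_le_aleph0 hdim
  have hS : ∀ x v w, S x v = w ↔ q x w = 0 ∧ T x w = p x v := by
    intro x v w
    have hqS : S x v ∈ LinearMap.ker (q x) := hSrange x ⟨v, rfl⟩
    have hTSv : T x (S x v) = p x v := LinearMap.congr_fun (hTS x) v
    refine ⟨?_, fun ⟨hqw, hTw⟩ => (hbij x).injOn hqS hqw (hTSv.trans hTw.symm)⟩
    rintro rfl
    exact ⟨hqS, hTSv⟩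
  intro v
  refine measurable_to_countable' fun w => ?_
  have hfiber : (fun x => S x v) ⁻¹' {w} = {x | q x w = 0} ∩ {x | T x w = p x v} := by
    ext x
    exact hS x v w
  rw [hfiber]
  exact (measurableSet_eq_fun (hqmeas w) measurable_const).inter
    (measurableSet_eq_fun (hTmeas w) (hpmeas v))
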